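/- Assume q is uniformly Lipschitz continuous in (μ,a) with Lipschitz constant L_q, and F, G are bounded by a constant C₀ and uniformly continuous in (μ,a) with modulus ρ. Let x⃗ = x⃗^N ∈ 𝕊^N₀ be such that μ^N_{x⃗} → μ ∈ 𝒫₀(𝕊) in W₁ as N → ∞. Then ∩_{ε>0} ∪_{L≥0} limsup_{N→∞} V^{N,ε,L}_state(t,μ^N_{x⃗}) ⊆ V_state(t,μ) ⊆ ∩_{ε>0} liminf_{N→∞} V^{N,ε,0}_state(t,μ^N_{x⃗}); in particular, since liminf_{N→∞} V^{N,ε,0}_state(t,μ^N_{x⃗}) ⊆ ∪_{L≥0} limsup_{N→∞} V^{N,ε,L}_state(t,μ^N_{x⃗}), all three sets are equal. -/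

import Mathlib

/-!
Statement 3 (Theorem 3.3, convergence of empirical measures for the `N`-player game
with homogeneous controls).

Finite-state mean field game; probability measures on the finite state space `S`
are encoded as functions `S → ℝ` (`IsProb`), with `W₁(μ,ν) = ∑_x |μ x − ν x|`.
Controls may depend on the current measure: `α : ℕ → S → (S → ℝ) → A`, and
`𝒜^L_state` is the class of such controls that are `L`-Lipschitz in the measure.
-/

open Finset

namespace MFGSetValue

variable {S A : Type*} [Fintype S] [DecidableEq S]

/-- A probability vector on the finite state space `S`. -/
def IsProb (μ : S → ℝ) : Prop := (∀ x, 0 ≤ μ x) ∧ ∑ x, μ x = 1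

/-- `W₁` distance (total-variation type) between two measures on `S`. -/
noncomputable def W1 (μ ν : S → ℝ) : ℝ := ∑ x, |μ x - ν x|

section Metric
variable [PseudoMetricSpace A]

/-- `α ∈ 𝒜^L_state`: measure-dependent controls, `L`-Lipschitz in the measure. -/
def LipCtrl (L : ℝ) (α : ℕ → S → (S → ℝ) → A) : Prop :=
  ∀ s x μ ν, dist (α s x μ) (α s x ν) ≤ L * W1 μ ν

end Metric

/-- The mean-field measure flow `μ^α` for a measure-dependent control `α`:
`μ^α_t = μ`, `μ^α_{s+1}(y) = ∑_x μ^α_s(x) q(s,x,μ^α_s,α(s,x,μ^α_s);y)`. -/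
noncomputable def flowM (q : ℕ → S → (S → ℝ) → A → S → ℝ)
    (α : ℕ → S → (S → ℝ) → A) (t : ℕ) (μ : S → ℝ) : ℕ → S → ℝ
  | 0 => μ
  | s + 1 =>
    if s + 1 ≤ t then μ
    else fun y => ∑ x, flowM q α t μ s x *
      q s x (flowM q α t μ s) (α s x (flowM q α t μ s)) y

/-- The law at each time of the Markov chain `ℙ^{μ^α; t, x₀, α̃}` started from `x₀`
at time `t`, with transitions `q(s,·,ν_s,α̃(s,·,ν_s);·)` against the flow `ν`. -/
noncomputable def chainM (q : ℕ → S → (S → ℝ) → A → S → ℝ) (ν : ℕ → S → ℝ)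
    (αt : ℕ → S → (S → ℝ) → A) (t : ℕ) (x₀ : S) : ℕ → S → ℝ
  | 0 => fun x => if x = x₀ then 1 else 0
  | s + 1 =>
    if s + 1 ≤ t then fun x => if x = x₀ then 1 else 0
    else fun y => ∑ x, chainM q ν αt t x₀ s x * q s x (ν s) (αt s x (ν s)) y

/-- The empirical measure `μ^N_{x⃗}` of a configuration `x⃗ ∈ 𝕊^N`. -/
noncomputable def emp {N : ℕ} (xv : Fin N → S) : S → ℝ :=
  fun x => (∑ i, if xv i = x then (1 : ℝ) else 0) / N

/-- The joint law `ℙ^{t,x⃗,α⃗}` of the `N`-player state process: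
`X⃗_t = x⃗` and independent transitions `q(s, x_i, μ^N_s, α^i(s,x_i,μ^N_s); ·)`. -/
noncomputable def jointFlow (q : ℕ → S → (S → ℝ) → A → S → ℝ) {N : ℕ}
    (αv : Fin N → ℕ → S → (S → ℝ) → A) (t : ℕ) (xv : Fin N → S) :
    ℕ → (Fin N → S) → ℝ
  | 0 => fun z => if z = xv then 1 else 0
  | s + 1 =>
    if s + 1 ≤ t then fun z => if z = xv then 1 else 0
    else fun z => ∑ w : Fin N → S, jointFlow q αv t xv s w *
      ∏ i, q s (w i) (emp w) (αv i s (w i) (emp w)) (z i)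

/-- The `N`-tuple `(α, α̃)_i`: player `i` uses `α̃`, all others use `α`. -/
def replaceI {N : ℕ} (α αt : ℕ → S → (S → ℝ) → A) (i : Fin N) :
    Fin N → ℕ → S → (S → ℝ) → A :=
  fun j => if j = i then αt else α


/-- The mean field game cost `J(t,μ,α;x₀,α̃) = E[G(X_T,μ^α_T) + ∑_{s=t}^{T-1} F(…)]`
for measure-dependent controls, against the flow `ν`. -/
noncomputable def costM (q : ℕ → S → (S → ℝ) → A → S → ℝ)
    (F : ℕ → S → (S → ℝ) → A → ℝ) (G : S → (S → ℝ) → ℝ) (T : ℕ)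
    (ν : ℕ → S → ℝ) (t : ℕ) (x₀ : S) (αt : ℕ → S → (S → ℝ) → A) : ℝ :=
  (∑ x, chainM q ν αt t x₀ T x * G x (ν T)) +
    ∑ s ∈ Finset.Ico t T, ∑ x, chainM q ν αt t x₀ s x * F s x (ν s) (αt s x (ν s))

/-- The value `v(ν; t, x₀) = inf_{α̃} J(ν; t, x₀, α̃)` over admissible controls. -/
noncomputable def valueM (q : ℕ → S → (S → ℝ) → A → S → ℝ)
    (F : ℕ → S → (S → ℝ) → A → ℝ) (G : S → (S → ℝ) → ℝ) (T : ℕ)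
    (ν : ℕ → S → ℝ) (t : ℕ) (x₀ : S) : ℝ :=
  sInf { r : ℝ | ∃ αt : ℕ → S → (S → ℝ) → A, r = costM q F G T ν t x₀ αt }

/-- The cost `J_i(t,x⃗,α⃗)` of player `i` in the `N`-player game. -/
noncomputable def Ji (q : ℕ → S → (S → ℝ) → A → S → ℝ)
    (F : ℕ → S → (S → ℝ) → A → ℝ) (G : S → (S → ℝ) → ℝ) (T : ℕ) {N : ℕ}
    (t : ℕ) (xv : Fin N → S) (αv : Fin N → ℕ → S → (S → ℝ) → A) (i : Fin N) : ℝ :=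
  (∑ w : Fin N → S, jointFlow q αv t xv T w * G (w i) (emp w)) +
    ∑ s ∈ Finset.Ico t T, ∑ w : Fin N → S,
      jointFlow q αv t xv s w * F s (w i) (emp w) (αv i s (w i) (emp w))

section Metric
variable [PseudoMetricSpace A]

/-- `v^{N,L}_i(t,x⃗,α) = inf_{α̃ ∈ 𝒜^L_state} J_i(t,x⃗,(α,α̃)_i)`. -/
noncomputable def vNi (q : ℕ → S → (S → ℝ) → A → S → ℝ)
    (F : ℕ → S → (S → ℝ) → A → ℝ) (G : S → (S → ℝ) → ℝ) (T : ℕ) (L : ℝ) {N : ℕ}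
    (t : ℕ) (xv : Fin N → S) (α : ℕ → S → (S → ℝ) → A) (i : Fin N) : ℝ :=
  sInf { r : ℝ | ∃ αt : ℕ → S → (S → ℝ) → A,
    LipCtrl L αt ∧ r = Ji q F G T t xv (replaceI α αt i) i }

end Metric


/-! ### State-dependent controls for the mean field game -/

/-- The measure flow `μ^α` for a state-dependent control `α ∈ 𝒜_state`. -/
noncomputable def flow (q : ℕ → S → (S → ℝ) → A → S → ℝ) (α : ℕ → S → A)
    (t : ℕ) (μ : S → ℝ) : ℕ → S → ℝ
  | 0 => μ
  | s + 1 =>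
    if s + 1 ≤ t then μ
    else fun y => ∑ x, flow q α t μ s x * q s x (flow q α t μ s) (α s x) y

/-- The law of the chain `ℙ^{{ν_·};t,x₀,α̃}` for a state-dependent control `α̃`. -/
noncomputable def chain (q : ℕ → S → (S → ℝ) → A → S → ℝ) (ν : ℕ → S → ℝ)
    (αt : ℕ → S → A) (t : ℕ) (x₀ : S) : ℕ → S → ℝ
  | 0 => fun x => if x = x₀ then 1 else 0
  | s + 1 =>
    if s + 1 ≤ t then fun x => if x = x₀ then 1 else 0
    else fun y => ∑ x, chain q ν αt t x₀ s x * q s x (ν s) (αt s x) y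

/-- The MFG cost `J({ν_·};t,x₀,α̃)` for a state-dependent control. -/
noncomputable def cost (q : ℕ → S → (S → ℝ) → A → S → ℝ)
    (F : ℕ → S → (S → ℝ) → A → ℝ) (G : S → (S → ℝ) → ℝ) (T : ℕ)
    (ν : ℕ → S → ℝ) (t : ℕ) (x₀ : S) (αt : ℕ → S → A) : ℝ :=
  (∑ x, chain q ν αt t x₀ T x * G x (ν T)) +
    ∑ s ∈ Finset.Ico t T, ∑ x, chain q ν αt t x₀ s x * F s x (ν s) (αt s x)

/-- The value `v({ν_·};t,x₀) = inf_{α̃ ∈ 𝒜_state} J({ν_·};t,x₀,α̃)`. -/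
noncomputable def value (q : ℕ → S → (S → ℝ) → A → S → ℝ)
    (F : ℕ → S → (S → ℝ) → A → ℝ) (G : S → (S → ℝ) → ℝ) (T : ℕ)
    (ν : ℕ → S → ℝ) (t : ℕ) (x₀ : S) : ℝ :=
  sInf { r : ℝ | ∃ αt : ℕ → S → A, r = cost q F G T ν t x₀ αt }

/-- `α ∈ ℳ^ε_state(t,μ)`. -/
def isMFEeps (q : ℕ → S → (S → ℝ) → A → S → ℝ)
    (F : ℕ → S → (S → ℝ) → A → ℝ) (G : S → (S → ℝ) → ℝ) (T : ℕ)
    (ε : ℝ) (t : ℕ) (μ : S → ℝ) (α : ℕ → S → A) : Prop :=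
  ∀ x, cost q F G T (flow q α t μ) t x α ≤ value q F G T (flow q α t μ) t x + ε

/-- `𝕍^ε_state(t,μ)`. -/
noncomputable def setValueEps (q : ℕ → S → (S → ℝ) → A → S → ℝ)
    (F : ℕ → S → (S → ℝ) → A → ℝ) (G : S → (S → ℝ) → ℝ) (T : ℕ)
    (ε : ℝ) (t : ℕ) (μ : S → ℝ) : Set (S → ℝ) :=
  { φ | ∃ α : ℕ → S → A, isMFEeps q F G T ε t μ α ∧
      ∀ x, |φ x - cost q F G T (flow q α t μ) t x α| ≤ ε }

/-- The MFG set value `𝕍_state(t,μ) = ⋂_{ε>0} 𝕍^ε_state(t,μ)`. -/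
noncomputable def setValue (q : ℕ → S → (S → ℝ) → A → S → ℝ)
    (F : ℕ → S → (S → ℝ) → A → ℝ) (G : S → (S → ℝ) → ℝ) (T : ℕ)
    (t : ℕ) (μ : S → ℝ) : Set (S → ℝ) :=
  ⋂ (ε : ℝ) (_ : 0 < ε), setValueEps q F G T ε t μ

section Metric
variable [PseudoMetricSpace A]

/-- `α* ∈ ℳ^{N,ε,L}_state(t,x⃗)`: a homogeneous state-dependent `(ε,L)`-equilibrium
of the `N`-player game. -/
def isNEquil (q : ℕ → S → (S → ℝ) → A → S → ℝ)
    (F : ℕ → S → (S → ℝ) → A → ℝ) (G : S → (S → ℝ) → ℝ) (T : ℕ)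
    (ε L : ℝ) {N : ℕ} (t : ℕ) (xv : Fin N → S) (α : ℕ → S → (S → ℝ) → A) : Prop :=
  LipCtrl L α ∧
    ∀ i : Fin N, Ji q F G T t xv (fun _ => α) i ≤ vNi q F G T L t xv α i + ε

/-- The `N`-player set value `𝕍^{N,ε,L}_state(t, μ^N_{x⃗})`. -/
noncomputable def setValueN (q : ℕ → S → (S → ℝ) → A → S → ℝ)
    (F : ℕ → S → (S → ℝ) → A → ℝ) (G : S → (S → ℝ) → ℝ) (T : ℕ)
    (ε L : ℝ) {N : ℕ} (t : ℕ) (xv : Fin N → S) : Set (S → ℝ) :=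
  { φ | ∃ α : ℕ → S → (S → ℝ) → A, isNEquil q F G T ε L t xv α ∧
      ∀ i : Fin N, |φ (xv i) - Ji q F G T t xv (fun _ => α) i| ≤ ε }

end Metric

end MFGSetValue

namespace MFGSetValue

section Helpers

set_option linter.unusedSectionVars false

/-- Standing assumptions bundled for the helper lemmas. -/
structure Hyp {S A : Type*} [Fintype S] [PseudoMetricSpace A]
    (q : ℕ → S → (S → ℝ) → A → S → ℝ) (F : ℕ → S → (S → ℝ) → A → ℝ)
    (G : S → (S → ℝ) → ℝ) (Lq C₀ : ℝ) (ρ : ℝ → ℝ) : Prop where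
  Lq0 : 0 ≤ Lq
  C0 : 0 ≤ C₀
  mono : Monotone ρ
  lim : Filter.Tendsto ρ (nhdsWithin 0 (Set.Ioi 0)) (nhds 0)
  qprob : ∀ s x μ a, IsProb μ → IsProb (q s x μ a)
  qLip : ∀ s x μ ν a b y, IsProb μ → IsProb ν →
      |q s x μ a y - q s x ν b y| ≤ Lq * (W1 μ ν + dist a b)
  Fbd : ∀ s x μ a, IsProb μ → |F s x μ a| ≤ C₀
  Gbd : ∀ x μ, IsProb μ → |G x μ| ≤ C₀
  Fuc : ∀ s x μ ν a b, IsProb μ → IsProb ν →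
      |F s x μ a - F s x ν b| ≤ ρ (W1 μ ν + dist a b)
  Guc : ∀ x μ ν, IsProb μ → IsProb ν → |G x μ - G x ν| ≤ ρ (W1 μ ν)

variable {S A : Type*} [Fintype S] [DecidableEq S]

lemma W1_nonneg (μ ν : S → ℝ) : 0 ≤ W1 μ ν :=
  Finset.sum_nonneg fun _ _ => abs_nonneg _

lemma IsProb.le_one {μ : S → ℝ} (h : IsProb μ) (x : S) : μ x ≤ 1 := by
  rw [← h.2]
  exact Finset.single_le_sum (fun y _ => h.1 y) (Finset.mem_univ x)

/-- expectation bound -/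
lemma IsProb.abs_avg {X : Type*} [Fintype X] {μ : X → ℝ} (h0 : ∀ x, 0 ≤ μ x)
    (h1 : ∑ x, μ x = 1) {f g : X → ℝ} (hfg : ∀ x, |f x| ≤ g x) :
    |∑ x, μ x * f x| ≤ ∑ x, μ x * g x := by
  refine (Finset.abs_sum_le_sum_abs _ _).trans (Finset.sum_le_sum fun x _ => ?_)
  rw [abs_mul, abs_of_nonneg (h0 x)]
  exact mul_le_mul_of_nonneg_left (hfg x) (h0 x)

lemma IsProb.abs_avg_const {X : Type*} [Fintype X] {μ : X → ℝ} (h0 : ∀ x, 0 ≤ μ x)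
    (h1 : ∑ x, μ x = 1) {f : X → ℝ} {c : ℝ} (hf : ∀ x, |f x| ≤ c) :
    |∑ x, μ x * f x| ≤ c := by
  have := IsProb.abs_avg h0 h1 (g := fun _ => c) hf
  rwa [← Finset.sum_mul, h1, one_mul] at this

lemma isProb_mix {X : Type*} [Fintype X] {μ : X → ℝ} (h0 : ∀ x, 0 ≤ μ x)
    (h1 : ∑ x, μ x = 1) {p : X → S → ℝ} (hp : ∀ x, IsProb (p x)) :
    IsProb (fun y => ∑ x, μ x * p x y) := by
  refine ⟨fun y => Finset.sum_nonneg fun x _ => mul_nonneg (h0 x) ((hp x).1 y), ?_⟩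
  rw [Finset.sum_comm]
  simp_rw [← Finset.mul_sum, (hp _).2, mul_one, h1]

lemma isProb_delta {X : Type*} [Fintype X] [DecidableEq X] (x₀ : X) :
    IsProb (fun x => if x = x₀ then (1 : ℝ) else 0) := by
  refine ⟨fun x => ?_, by simp⟩
  dsimp only
  split_ifs <;> norm_num

lemma emp_isProb {N : ℕ} (hN : 1 ≤ N) (w : Fin N → S) : IsProb (emp w) := by
  have hN' : (N : ℝ) ≠ 0 := by positivity
  refine ⟨fun x => ?_, ?_⟩
  · unfold emp
    refine div_nonneg (Finset.sum_nonneg fun i _ => ?_) (by positivity)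
    split_ifs <;> norm_num
  · unfold emp
    rw [← Finset.sum_div, Finset.sum_comm]
    simp [hN']

lemma emp_avg {N : ℕ} (w : Fin N → S) (f : S → ℝ) :
    ∑ x, emp w x * f x = (∑ j, f (w j)) / N := by
  unfold emp
  simp_rw [div_mul_eq_mul_div, Finset.sum_mul]
  rw [← Finset.sum_div, Finset.sum_comm]
  simp

/-! product weights -/

lemma prodW_sum {N : ℕ} (p h : Fin N → S → ℝ) :
    ∑ z : Fin N → S, (∏ j, p j (z j)) * ∏ j, h j (z j) = ∏ j, ∑ x, p j x * h j x := by
  rw [Finset.prod_univ_sum]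
  simp [Fintype.piFinset_univ, Finset.prod_mul_distrib]

lemma prodW_isProb {N : ℕ} {p : Fin N → S → ℝ} (hp : ∀ j, IsProb (p j)) :
    IsProb (fun z : Fin N → S => ∏ j, p j (z j)) := by
  refine ⟨fun z => Finset.prod_nonneg fun j _ => (hp j).1 _, ?_⟩
  have := prodW_sum p (fun _ _ => 1)
  simpa [(hp _).2] using this

lemma prodW_marg {N : ℕ} {p : Fin N → S → ℝ} (hp : ∀ j, IsProb (p j)) (a : Fin N)
    (g : S → ℝ) :
    ∑ z : Fin N → S, (∏ j, p j (z j)) * g (z a) = ∑ x, p a x * g x := by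
  have := prodW_sum p (fun j x => if j = a then g x else 1)
  simp only [Finset.prod_ite_eq', Finset.mem_univ, if_true] at this
  rw [this, Finset.prod_eq_single a]
  · simp
  · intro b _ hb
    simp [hb, (hp b).2]
  · simp

lemma prodW_pair {N : ℕ} {p : Fin N → S → ℝ} {a b : Fin N} (hab : a ≠ b)
    (g : Fin N → S → ℝ) (h0 : ∑ x, p a x * g a x = 0) :
    ∑ z : Fin N → S, (∏ j, p j (z j)) * (g a (z a) * g b (z b)) = 0 := by
  have := prodW_sum p
    (fun j x => (if j = a then g j x else 1) * (if j = b then g j x else 1))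
  simp only [Finset.prod_mul_distrib, Finset.prod_ite_eq', Finset.mem_univ, if_true] at this
  rw [this]
  refine Finset.prod_eq_zero (Finset.mem_univ a) ?_
  simpa [hab] using h0

lemma lln {N : ℕ} (hN : 1 ≤ N) {p : Fin N → S → ℝ} (hp : ∀ j, IsProb (p j)) (y : S) :
    ∑ z : Fin N → S, (∏ j, p j (z j)) * |emp z y - (∑ j, p j y) / N| ≤ 1 / √N := by
  have hNpos : (0 : ℝ) < N := by positivity
  set g : Fin N → S → ℝ := fun j x => (if x = y then 1 else 0) - p j y with hg
  have hgz : ∀ j, ∑ x, p j x * g j x = 0 := by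
    intro j
    simp [hg, mul_sub, Finset.sum_sub_distrib, ← Finset.sum_mul, (hp j).2]
  have hgb : ∀ j x, |g j x| ≤ 1 := by
    intro j x
    have h0 := (hp j).1 y
    have h1 := (hp j).le_one y
    rw [abs_le]
    simp only [hg]
    split_ifs <;> constructor <;> linarith
  have hP := prodW_isProb hp
  have hdiff : ∀ z : Fin N → S, emp z y - (∑ j, p j y) / N = (∑ j, g j (z j)) / N := by
    intro z
    simp [emp, hg, Finset.sum_sub_distrib, sub_div]
  have hsq : ∑ z : Fin N → S, (∏ j, p j (z j)) * (∑ j, g j (z j)) ^ 2 ≤ N := by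
    have e1 : ∀ z : Fin N → S, (∏ j, p j (z j)) * (∑ j, g j (z j)) ^ 2
        = ∑ a, ∑ b, (∏ j, p j (z j)) * (g a (z a) * g b (z b)) := by
      intro z
      rw [sq, Finset.sum_mul_sum, Finset.mul_sum]
      simp_rw [Finset.mul_sum]
    simp_rw [e1]
    rw [Finset.sum_comm]
    calc ∑ a, ∑ z : Fin N → S, ∑ b, (∏ j, p j (z j)) * (g a (z a) * g b (z b))
        ≤ ∑ a : Fin N, (1 : ℝ) := by
          refine Finset.sum_le_sum fun a _ => ?_
          rw [Finset.sum_comm, Finset.sum_eq_single a]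
          · refine (le_abs_self _).trans
              (IsProb.abs_avg_const hP.1 hP.2 (f := fun z => g a (z a) * g a (z a)) ?_)
            intro z
            rw [abs_mul]
            exact mul_le_one₀ (hgb _ _) (abs_nonneg _) (hgb _ _)
          · intro b _ hb
            exact prodW_pair hb.symm g (hgz a)
          · simp
      _ = N := by simp
  have hs : 0 < √(N : ℝ) := Real.sqrt_pos.2 hNpos
  have hss : √(N : ℝ) * √(N : ℝ) = N := Real.mul_self_sqrt hNpos.le
  have hpt : ∀ u : ℝ, |u / N| ≤ (1 / (2 * √N)) + (1 / (2 * √N * N)) * u ^ 2 := by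
    intro u
    rw [abs_div, abs_of_pos hNpos, div_le_iff₀ hNpos]
    have : (1 / (2 * √(N:ℝ)) + (1 / (2 * √N * N)) * u ^ 2) * N
      = (N + u ^ 2) / (2 * √N) := by field_simp
    rw [this, le_div_iff₀ (by positivity)]
    nlinarith [sq_nonneg (√(N:ℝ) - |u|), sq_abs u]
  calc ∑ z : Fin N → S, (∏ j, p j (z j)) * |emp z y - (∑ j, p j y) / N|
      ≤ ∑ z : Fin N → S, (∏ j, p j (z j)) *
          ((1 / (2 * √N)) + (1 / (2 * √N * N)) * (∑ j, g j (z j)) ^ 2) := by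
        refine Finset.sum_le_sum fun z _ => mul_le_mul_of_nonneg_left ?_ (hP.1 z)
        rw [hdiff]
        exact hpt _
    _ = (1 / (2 * √N)) + (1 / (2 * √N * N)) *
          ∑ z : Fin N → S, (∏ j, p j (z j)) * (∑ j, g j (z j)) ^ 2 := by
        simp_rw [mul_add]
        rw [Finset.sum_add_distrib, ← Finset.sum_mul, hP.2, one_mul, Finset.mul_sum]
        congr 1
        refine Finset.sum_congr rfl fun z _ => ?_
        ring
    _ ≤ (1 / (2 * √N)) + (1 / (2 * √N * N)) * N := by
        gcongr
    _ = 1 / √N := by field_simp; norm_num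

variable [PseudoMetricSpace A]
variable {q : ℕ → S → (S → ℝ) → A → S → ℝ} {F : ℕ → S → (S → ℝ) → A → ℝ}
  {G : S → (S → ℝ) → ℝ} {Lq C₀ : ℝ} {ρ : ℝ → ℝ}

lemma flowM_isProb (H : Hyp q F G Lq C₀ ρ) (α : ℕ → S → (S → ℝ) → A) (t : ℕ)
    {μ : S → ℝ} (hμ : IsProb μ) : ∀ s, IsProb (flowM q α t μ s)
  | 0 => by simpa [flowM] using hμ
  | s + 1 => by
    rw [flowM]
    split_ifs
    · exact hμ
    · have ih := flowM_isProb H α t hμ s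
      exact isProb_mix ih.1 ih.2 fun x => H.qprob _ _ _ _ ih

lemma chainM_isProb (H : Hyp q F G Lq C₀ ρ) {ν : ℕ → S → ℝ} (hν : ∀ s, IsProb (ν s))
    (α : ℕ → S → (S → ℝ) → A) (t : ℕ) (x₀ : S) : ∀ s, IsProb (chainM q ν α t x₀ s)
  | 0 => by rw [chainM]; exact isProb_delta x₀
  | s + 1 => by
    rw [chainM]
    split_ifs
    · exact isProb_delta x₀
    · have ih := chainM_isProb H hν α t x₀ s
      exact isProb_mix ih.1 ih.2 fun x => H.qprob _ _ _ _ (hν s)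

lemma joint_isProb (H : Hyp q F G Lq C₀ ρ) {N : ℕ} (hN : 1 ≤ N)
    (αv : Fin N → ℕ → S → (S → ℝ) → A) (t : ℕ) (xv : Fin N → S) :
    ∀ s, IsProb (jointFlow q αv t xv s)
  | 0 => by rw [jointFlow]; exact isProb_delta xv
  | s + 1 => by
    rw [jointFlow]
    split_ifs
    · exact isProb_delta xv
    · have ih := joint_isProb H hN αv t xv s
      exact isProb_mix ih.1 ih.2 fun w =>
        prodW_isProb fun j => H.qprob _ _ _ _ (emp_isProb hN w)

lemma joint_step {N : ℕ} (αv : Fin N → ℕ → S → (S → ℝ) → A) (t : ℕ) (xv : Fin N → S)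
    {s : ℕ} (hs : ¬ s + 1 ≤ t) (f : (Fin N → S) → ℝ) :
    ∑ z, jointFlow q αv t xv (s + 1) z * f z = ∑ w, jointFlow q αv t xv s w *
      ∑ z : Fin N → S, (∏ i, q s (w i) (emp w) (αv i s (w i) (emp w)) (z i)) * f z := by
  rw [jointFlow, if_neg hs]
  simp_rw [Finset.sum_mul, Finset.mul_sum]
  rw [Finset.sum_comm]
  simp_rw [mul_assoc]

/-- Lipschitz bound for the closed loop transition. -/
lemma q_closed (H : Hyp q F G Lq C₀ ρ) {L : ℝ} {α : ℕ → S → (S → ℝ) → A}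
    (hα : LipCtrl L α) (s : ℕ) (x y : S) {μ ν : S → ℝ} (hμ : IsProb μ) (hν : IsProb ν) :
    |q s x μ (α s x μ) y - q s x ν (α s x ν) y| ≤ Lq * (1 + L) * W1 μ ν := by
  refine (H.qLip s x μ ν _ _ y hμ hν).trans ?_
  have := hα s x μ ν
  have h2 := mul_le_mul_of_nonneg_left this H.Lq0
  nlinarith

/-- One step estimate. -/
lemma one_step (H : Hyp q F G Lq C₀ ρ) {L : ℝ} (hL : 0 ≤ L) {N : ℕ} (hN : 1 ≤ N)
    {α αt : ℕ → S → (S → ℝ) → A} (hα : LipCtrl L α) (i : Fin N) (s : ℕ)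
    (w : Fin N → S) {ν : S → ℝ} (hν : IsProb ν) :
    ∑ z : Fin N → S,
      (∏ j, q s (w j) (emp w) (replaceI α αt i j s (w j) (emp w)) (z j)) *
        W1 (emp z) (fun y => ∑ x, ν x * q s x ν (α s x ν) y)
      ≤ Fintype.card S * (2 / √N + (1 + Lq * (1 + L)) * W1 (emp w) ν) := by
  have hNpos : (0 : ℝ) < N := by positivity
  have hN1 : (1 : ℝ) ≤ N := by exact_mod_cast hN
  have hE := emp_isProb hN w
  set p : Fin N → S → ℝ :=
    fun j => q s (w j) (emp w) (replaceI α αt i j s (w j) (emp w)) with hpdef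
  have hp : ∀ j, IsProb (p j) := fun j => H.qprob _ _ _ _ hE
  have hP := prodW_isProb hp
  have hs : 0 < √(N : ℝ) := Real.sqrt_pos.2 hNpos
  have hsN : 1 / (N : ℝ) ≤ 1 / √N := by
    apply one_div_le_one_div_of_le hs
    rw [Real.sqrt_le_left hNpos.le]
    nlinarith
  -- deterministic comparison
  have hdet : ∀ y, |(∑ j, p j y) / N - ∑ x, ν x * q s x ν (α s x ν) y|
      ≤ 1 / √N + (1 + Lq * (1 + L)) * W1 (emp w) ν := by
    intro y
    have h1 : |(∑ j, p j y) / N - ∑ x, emp w x * q s x (emp w) (α s x (emp w)) y| ≤ 1 / N := by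
      rw [emp_avg w (fun x => q s x (emp w) (α s x (emp w)) y), ← sub_div,
        ← Finset.sum_sub_distrib, abs_div, abs_of_pos hNpos]
      refine div_le_div_of_nonneg_right ?_ hNpos.le
      rw [Finset.sum_eq_single i]
      · have a1 := (hp i).1 y
        have a2 := (hp i).le_one y
        have a3 := H.qprob s (w i) (emp w) (α s (w i) (emp w)) hE
        have a4 := a3.1 y
        have a5 := a3.le_one y
        rw [abs_le]; constructor <;> linarith
      · intro b _ hb
        simp [hpdef, replaceI, hb]
      · simp
    have h2 : |∑ x, emp w x * q s x (emp w) (α s x (emp w)) y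
        - ∑ x, emp w x * q s x ν (α s x ν) y| ≤ Lq * (1 + L) * W1 (emp w) ν := by
      rw [← Finset.sum_sub_distrib]
      simp_rw [← mul_sub]
      exact IsProb.abs_avg_const hE.1 hE.2 fun x => q_closed H hα s x y hE hν
    have h3 : |∑ x, emp w x * q s x ν (α s x ν) y - ∑ x, ν x * q s x ν (α s x ν) y|
        ≤ W1 (emp w) ν := by
      rw [← Finset.sum_sub_distrib]
      simp_rw [← sub_mul]
      refine (Finset.abs_sum_le_sum_abs _ _).trans (Finset.sum_le_sum fun x _ => ?_)
      have a3 := H.qprob s x ν (α s x ν) hν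
      rw [abs_mul, abs_of_nonneg (a3.1 y)]
      exact mul_le_of_le_one_right (abs_nonneg _) (a3.le_one y)
    have h4 := abs_sub_le ((∑ j, p j y) / N)
      (∑ x, emp w x * q s x (emp w) (α s x (emp w)) y) (∑ x, ν x * q s x ν (α s x ν) y)
    have h5 := abs_sub_le (∑ x, emp w x * q s x (emp w) (α s x (emp w)) y)
      (∑ x, emp w x * q s x ν (α s x ν) y) (∑ x, ν x * q s x ν (α s x ν) y)
    linarith
  have hsw : ∑ z : Fin N → S, (∏ j, p j (z j)) *
        W1 (emp z) (fun y => ∑ x, ν x * q s x ν (α s x ν) y)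
      = ∑ y, ∑ z : Fin N → S, (∏ j, p j (z j)) *
        |emp z y - ∑ x, ν x * q s x ν (α s x ν) y| := by
    rw [Finset.sum_comm]
    refine Finset.sum_congr rfl fun z _ => ?_
    rw [W1, Finset.mul_sum]
  rw [hsw]
  have hy : ∀ y ∈ (Finset.univ : Finset S), ∑ z : Fin N → S, (∏ j, p j (z j)) *
      |emp z y - ∑ x, ν x * q s x ν (α s x ν) y|
      ≤ 2 / √N + (1 + Lq * (1 + L)) * W1 (emp w) ν := by
    intro y _
    calc ∑ z : Fin N → S, (∏ j, p j (z j)) * |emp z y - ∑ x, ν x * q s x ν (α s x ν) y|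
        ≤ ∑ z : Fin N → S, ((∏ j, p j (z j)) * |emp z y - (∑ j, p j y) / N| +
            (∏ j, p j (z j)) * (1 / √N + (1 + Lq * (1 + L)) * W1 (emp w) ν)) := by
          refine Finset.sum_le_sum fun z _ => ?_
          rw [← mul_add]
          refine mul_le_mul_of_nonneg_left ?_ (hP.1 z)
          exact (abs_sub_le _ ((∑ j, p j y) / N) _).trans (by gcongr; exact hdet y)
      _ ≤ 1 / √N + (1 / √N + (1 + Lq * (1 + L)) * W1 (emp w) ν) := by
          rw [Finset.sum_add_distrib, ← Finset.sum_mul, hP.2, one_mul]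
          gcongr
          exact lln hN hp y
      _ = _ := by ring
  refine (Finset.sum_le_card_nsmul _ _ _ hy).trans (le_of_eq ?_)
  rw [nsmul_eq_mul, Finset.card_univ]

/-- Convergence of empirical measures. -/
lemma emp_conv (H : Hyp q F G Lq C₀ ρ) {L : ℝ} (hL : 0 ≤ L) (t : ℕ) {μ : S → ℝ}
    (hμ : IsProb μ) (xv : (N : ℕ) → Fin N → S)
    (hconv : Filter.Tendsto (fun N => W1 (emp (xv N)) μ) Filter.atTop (nhds 0)) (s : ℕ) :
    ∀ η > 0, ∀ᶠ N in Filter.atTop, ∀ α αt : ℕ → S → (S → ℝ) → A, LipCtrl L α →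
      ∀ i : Fin N, ∑ w, jointFlow q (replaceI α αt i) t (xv N) s w *
        W1 (emp w) (flowM q α t μ s) ≤ η := by
  have hbase : ∀ η > 0, ∀ᶠ N in Filter.atTop, W1 (emp (xv N)) μ ≤ η := fun η hη =>
    hconv.eventually (ge_mem_nhds hη)
  induction s with
  | zero =>
    intro η hη
    filter_upwards [hbase η hη] with N hN α αt hα i
    simpa [jointFlow, flowM] using hN
  | succ s ih =>
    intro η hη
    by_cases hs : s + 1 ≤ t
    · filter_upwards [hbase η hη] with N hN α αt hα i
      simpa [jointFlow, flowM, hs] using hN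
    · set c : ℝ := (Fintype.card S : ℝ) with hc
      have hc0 : 0 ≤ c := by positivity
      set K : ℝ := 1 + Lq * (1 + L) with hK
      have hK0 : 0 ≤ K := by have := H.Lq0; positivity
      have hsq : ∀ᶠ N : ℕ in Filter.atTop, c * (2 / √(N:ℝ)) ≤ η / 2 := by
        have : Filter.Tendsto (fun N : ℕ => c * (2 / √(N:ℝ))) Filter.atTop (nhds (c * 0)) :=
          (Filter.Tendsto.const_div_atTop
            (Real.tendsto_sqrt_atTop.comp tendsto_natCast_atTop_atTop) 2).const_mul c
        rw [mul_zero] at this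
        exact this.eventually (ge_mem_nhds (half_pos hη))
      have hη' : 0 < η / 2 / (c * K + 1) := by positivity
      filter_upwards [ih _ hη', hsq, Filter.eventually_ge_atTop 1] with N h1 h2 hN α αt hα i
      have hJ := joint_isProb H hN (replaceI α αt i) t (xv N) s
      rw [joint_step _ _ _ hs]
      have hfl : flowM q α t μ (s + 1) = fun y => ∑ x, flowM q α t μ s x *
          q s x (flowM q α t μ s) (α s x (flowM q α t μ s)) y := by
        rw [flowM, if_neg hs]
      rw [hfl]
      calc _ ≤ ∑ w, jointFlow q (replaceI α αt i) t (xv N) s w *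
              (c * (2 / √N + K * W1 (emp w) (flowM q α t μ s))) :=
            Finset.sum_le_sum fun w _ => mul_le_mul_of_nonneg_left
              (one_step H hL hN hα i s w (flowM_isProb H α t hμ s)) (hJ.1 w)
        _ = c * (2 / √N) + c * K * ∑ w, jointFlow q (replaceI α αt i) t (xv N) s w *
              W1 (emp w) (flowM q α t μ s) := by
            simp_rw [mul_add]
            rw [Finset.sum_add_distrib, ← Finset.sum_mul, hJ.2, one_mul, Finset.mul_sum]
            congr 1
            refine Finset.sum_congr rfl fun w _ => ?_
            ring
        _ ≤ η / 2 + c * K * (η / 2 / (c * K + 1)) := by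
            gcongr
            exact h1 α αt hα i
        _ ≤ η := by
            have : c * K * (η / 2 / (c * K + 1)) ≤ η / 2 := by
              rw [mul_div_assoc', div_le_iff₀ (by positivity)]
              nlinarith
            linarith

lemma replaceI_self {N : ℕ} (α αt : ℕ → S → (S → ℝ) → A) (i : Fin N) :
    replaceI α αt i i = αt := by simp [replaceI]

lemma replaceI_same {N : ℕ} (α : ℕ → S → (S → ℝ) → A) (i : Fin N) :
    replaceI α α i = fun _ => α := by funext j; simp [replaceI]

/-- Generic perturbation of an expectation from the empirical measure to the flow. -/
lemma perturb {N : ℕ} {P : (Fin N → S) → ℝ} (hP : IsProb P) (i : Fin N)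
    {ν : S → ℝ} {f : S → (S → ℝ) → ℝ} {K e : ℝ}
    (hf : ∀ w : Fin N → S, ∀ x, |f x (emp w) - f x ν| ≤ e + K * W1 (emp w) ν) :
    |∑ w, P w * f (w i) (emp w) - ∑ w, P w * f (w i) ν|
      ≤ e + K * ∑ w, P w * W1 (emp w) ν := by
  rw [← Finset.sum_sub_distrib]
  simp_rw [← mul_sub]
  refine (IsProb.abs_avg hP.1 hP.2 (fun w => hf w (w i))).trans (le_of_eq ?_)
  simp_rw [mul_add]
  rw [Finset.sum_add_distrib, ← Finset.sum_mul, hP.2, one_mul, Finset.mul_sum]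
  congr 1
  refine Finset.sum_congr rfl fun w _ => ?_
  ring

/-- Convergence of the marginal law of the (deviating) player. -/
lemma marg_conv (H : Hyp q F G Lq C₀ ρ) {L : ℝ} (hL : 0 ≤ L) (t : ℕ) {μ : S → ℝ}
    (hμ : IsProb μ) (xv : (N : ℕ) → Fin N → S)
    (hconv : Filter.Tendsto (fun N => W1 (emp (xv N)) μ) Filter.atTop (nhds 0))
    (B : ℝ) (hB : 0 ≤ B) (s : ℕ) :
    ∀ η > 0, ∀ᶠ N in Filter.atTop, ∀ α αt : ℕ → S → (S → ℝ) → A, LipCtrl L α →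
      LipCtrl L αt → ∀ i : Fin N, ∀ h : S → ℝ, (∀ x, |h x| ≤ B) →
      |∑ w, jointFlow q (replaceI α αt i) t (xv N) s w * h (w i) -
        ∑ x, chainM q (flowM q α t μ) αt t (xv N i) s x * h x| ≤ η := by
  induction s with
  | zero =>
    intro η hη
    refine Filter.Eventually.of_forall fun N α αt _ _ i h _ => ?_
    simpa [jointFlow, chainM] using hη.le
  | succ s ih =>
    intro η hη
    by_cases hs : s + 1 ≤ t
    · refine Filter.Eventually.of_forall fun N α αt _ _ i h _ => ?_
      simpa [jointFlow, chainM, hs] using hη.le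
    · set K : ℝ := Fintype.card S * (Lq * (1 + L) * B) with hK
      have hK0 : 0 ≤ K := by have := H.Lq0; positivity
      have hη' : 0 < η / 2 / (K + 1) := by positivity
      filter_upwards [ih _ (half_pos hη), emp_conv H hL t hμ xv hconv s _ hη',
        Filter.eventually_ge_atTop 1] with N h1 h2 hN α αt hα hαt i h hh
      have hJ := joint_isProb H hN (replaceI α αt i) t (xv N) s
      have hν := flowM_isProb H α t hμ s
      set ν := flowM q α t μ s with hνd
      rw [joint_step _ _ _ hs (fun z => h (z i))]
      set f : S → (S → ℝ) → ℝ := fun x m => ∑ y, q s x m (αt s x m) y * h y with hf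
      have e1 : ∀ w : Fin N → S, ∑ z : Fin N → S,
          (∏ j, q s (w j) (emp w) (replaceI α αt i j s (w j) (emp w)) (z j)) * h (z i)
          = f (w i) (emp w) := by
        intro w
        rw [prodW_marg (p := fun j => q s (w j) (emp w) (replaceI α αt i j s (w j) (emp w)))
          (fun j => H.qprob _ _ _ _ (emp_isProb hN w)) i h]
        simp only [replaceI_self, hf]
      simp_rw [e1]
      have e2 : ∑ x, chainM q (flowM q α t μ) αt t (xv N i) (s + 1) x * h x
          = ∑ x, chainM q (flowM q α t μ) αt t (xv N i) s x * f x ν := by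
        rw [chainM, if_neg hs]
        simp_rw [hf, Finset.sum_mul, Finset.mul_sum]
        rw [Finset.sum_comm]
        simp_rw [mul_assoc]
        rfl
      rw [e2]
      have e3 : ∀ x, |f x ν| ≤ B := fun x => by
        have := H.qprob s x ν (αt s x ν) hν
        exact IsProb.abs_avg_const this.1 this.2 hh
      have e4 : ∀ w : Fin N → S, ∀ x, |f x (emp w) - f x ν| ≤ 0 + K * W1 (emp w) ν := by
        intro w x
        simp only [hf]
        rw [← Finset.sum_sub_distrib, zero_add]
        simp_rw [← sub_mul]
        refine (Finset.abs_sum_le_sum_abs _ _).trans ?_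
        have : ∀ y ∈ (Finset.univ : Finset S),
            |(q s x (emp w) (αt s x (emp w)) y - q s x ν (αt s x ν) y) * h y|
            ≤ Lq * (1 + L) * W1 (emp w) ν * B := by
          intro y _
          rw [abs_mul]
          have h3 := q_closed H hαt s x y (emp_isProb hN w) hν
          exact mul_le_mul h3 (hh y) (abs_nonneg _) ((abs_nonneg _).trans h3)
        refine (Finset.sum_le_card_nsmul _ _ _ this).trans (le_of_eq ?_)
        rw [nsmul_eq_mul, Finset.card_univ, hK]
        ring
      have h3 := perturb hJ i e4
      have h4 := h1 α αt hα hαt i (fun x => f x ν) e3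
      have h5 := mul_le_mul_of_nonneg_left (h2 α αt hα i) hK0
      have h6 : K * (η / 2 / (K + 1)) ≤ η / 2 := by
        rw [mul_div_assoc', div_le_iff₀ (by positivity)]
        nlinarith
      have h7 := abs_sub_le
        (∑ w, jointFlow q (replaceI α αt i) t (xv N) s w * f (w i) (emp w))
        (∑ w, jointFlow q (replaceI α αt i) t (xv N) s w * f (w i) ν)
        (∑ x, chainM q (flowM q α t μ) αt t (xv N i) s x * f x ν)
      linarith

/-- Convergence of the expectation of a function of state and measure. -/
lemma fun_conv (H : Hyp q F G Lq C₀ ρ) {L : ℝ} (hL : 0 ≤ L) (t : ℕ) {μ : S → ℝ}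
    (hμ : IsProb μ) (xv : (N : ℕ) → Fin N → S)
    (hconv : Filter.Tendsto (fun N => W1 (emp (xv N)) μ) Filter.atTop (nhds 0))
    (B K : ℝ) (hB : 0 ≤ B) (hK0 : 0 ≤ K) (s : ℕ) (η : ℝ) (hη : 0 < η) :
    ∀ᶠ N in Filter.atTop, ∀ α αt : ℕ → S → (S → ℝ) → A, LipCtrl L α →
      LipCtrl L αt → ∀ i : Fin N, ∀ f : S → (S → ℝ) → ℝ,
      (∀ x m, IsProb m → |f x m| ≤ B) →
      (∀ x m m', IsProb m → IsProb m' → |f x m - f x m'| ≤ η / 3 + K * W1 m m') →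
      |∑ w, jointFlow q (replaceI α αt i) t (xv N) s w * f (w i) (emp w) -
        ∑ x, chainM q (flowM q α t μ) αt t (xv N i) s x * f x (flowM q α t μ s)| ≤ η := by
  have hη' : 0 < η / 3 / (K + 1) := by positivity
  filter_upwards [marg_conv H hL t hμ xv hconv B hB s (η / 3) (by positivity),
    emp_conv H hL t hμ xv hconv s _ hη', Filter.eventually_ge_atTop 1]
    with N h1 h2 hN α αt hα hαt i f hfB hfu
  have hJ := joint_isProb H hN (replaceI α αt i) t (xv N) s
  have hν := flowM_isProb H α t hμ s
  have h3 := perturb hJ i (fun w x => hfu x (emp w) _ (emp_isProb hN w) hν)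
  have h4 := h1 α αt hα hαt i (fun x => f x (flowM q α t μ s)) (fun x => hfB x _ hν)
  have h5 := mul_le_mul_of_nonneg_left (h2 α αt hα i) hK0
  have h6 : K * (η / 3 / (K + 1)) ≤ η / 3 := by
    rw [mul_div_assoc', div_le_iff₀ (by positivity)]
    nlinarith
  have h7 := abs_sub_le
    (∑ w, jointFlow q (replaceI α αt i) t (xv N) s w * f (w i) (emp w))
    (∑ w, jointFlow q (replaceI α αt i) t (xv N) s w * f (w i) (flowM q α t μ s))
    (∑ x, chainM q (flowM q α t μ) αt t (xv N i) s x * f x (flowM q α t μ s))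
  linarith

lemma modulus (H : Hyp q F G Lq C₀ ρ) (η : ℝ) (hη : 0 < η) :
    ∃ K, 0 ≤ K ∧ ∀ d r, 0 ≤ r → |d| ≤ ρ r → |d| ≤ 2 * C₀ → |d| ≤ η + K * r := by
  have h1 : ∀ᶠ r in nhdsWithin (0:ℝ) (Set.Ioi 0), ρ r ≤ η := H.lim.eventually (ge_mem_nhds hη)
  obtain ⟨δ, hδ, hδ0⟩ := (h1.and self_mem_nhdsWithin).exists
  have hδ0 : 0 < δ := hδ0
  have hC := H.C0
  refine ⟨2 * C₀ / δ, by positivity, fun d r hr h2 h3 => ?_⟩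
  rcases le_total r δ with h | h
  · have := H.mono h
    have : 0 ≤ 2 * C₀ / δ * r := by positivity
    linarith
  · have : 2 * C₀ ≤ 2 * C₀ / δ * r := by
      rw [div_mul_eq_mul_div, le_div_iff₀ hδ0]
      exact mul_le_mul_of_nonneg_left h (by positivity)
    linarith

lemma cost_conv (H : Hyp q F G Lq C₀ ρ) {L : ℝ} (hL : 0 ≤ L) (T t : ℕ) {μ : S → ℝ}
    (hμ : IsProb μ) (xv : (N : ℕ) → Fin N → S)
    (hconv : Filter.Tendsto (fun N => W1 (emp (xv N)) μ) Filter.atTop (nhds 0))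
    (η : ℝ) (hη : 0 < η) :
    ∀ᶠ N in Filter.atTop, ∀ α αt : ℕ → S → (S → ℝ) → A, LipCtrl L α →
      LipCtrl L αt → ∀ i : Fin N,
      |Ji q F G T t (xv N) (replaceI α αt i) i
        - costM q F G T (flowM q α t μ) t (xv N i) αt| ≤ η := by
  set e : ℝ := η / (T + 1) with he
  have he0 : 0 < e := by positivity
  obtain ⟨K, hK, hmod⟩ := modulus H (e / 3) (by positivity)
  have hK' : 0 ≤ K * (1 + L) := by positivity
  have hfc := fun s => fun_conv H hL t hμ xv hconv C₀ (K * (1 + L)) H.C0 hK' s e he0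
  filter_upwards [(Filter.eventually_all_finset (Finset.range (T + 1))).2 (fun s _ => hfc s)]
    with N hN α αt hα hαt i
  have hG := hN T (by simp) α αt hα hαt i G (fun x m hm => H.Gbd x m hm) (by
    intro x m m' hm hm'
    have h0 := W1_nonneg m m'
    refine (hmod _ _ h0 (H.Guc x m m' hm hm') ?_).trans ?_
    · have := H.Gbd x m hm
      have := H.Gbd x m' hm'
      exact (abs_sub _ _).trans (by linarith)
    · nlinarith [mul_nonneg (mul_nonneg hK hL) h0])
  have hF : ∀ s ∈ Finset.Ico t T,
      |∑ w, jointFlow q (replaceI α αt i) t (xv N) s w *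
          F s (w i) (emp w) (replaceI α αt i i s (w i) (emp w)) -
        ∑ x, chainM q (flowM q α t μ) αt t (xv N i) s x *
          F s x (flowM q α t μ s) (αt s x (flowM q α t μ s))| ≤ e := by
    intro s hs
    rw [replaceI_self]
    rw [Finset.mem_Ico] at hs
    refine hN s (by simp; omega) α αt hα hαt i (fun x m => F s x m (αt s x m))
      (fun x m hm => H.Fbd s x m _ hm) ?_
    intro x m m' hm hm'
    have h0 := W1_nonneg m m'
    refine (hmod _ _ (add_nonneg h0 dist_nonneg) (H.Fuc s x m m' _ _ hm hm') ?_).trans ?_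
    · have := H.Fbd s x m (αt s x m) hm
      have := H.Fbd s x m' (αt s x m') hm'
      exact (abs_sub _ _).trans (by linarith)
    · have := mul_le_mul_of_nonneg_left (hαt s x m m') hK
      nlinarith
  unfold Ji costM
  rw [add_sub_add_comm, ← Finset.sum_sub_distrib]
  refine (abs_add_le _ _).trans ?_
  have h2 := (Finset.abs_sum_le_sum_abs _ _).trans (Finset.sum_le_card_nsmul _ _ _ hF)
  rw [nsmul_eq_mul, Nat.card_Ico] at h2
  have h3 : ((T - t : ℕ) : ℝ) ≤ T := by exact_mod_cast Nat.sub_le T t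
  have h4 := mul_le_mul_of_nonneg_right h3 he0.le
  have h5 : e + T * e = η := by rw [he]; field_simp; ring
  linarith

/-- Boundedness of the `N`-player cost. -/
lemma Ji_bdd (H : Hyp q F G Lq C₀ ρ) (T t : ℕ) {N : ℕ} (hN : 1 ≤ N) (xv : Fin N → S)
    (αv : Fin N → ℕ → S → (S → ℝ) → A) (i : Fin N) :
    -(C₀ + (T - t : ℕ) * C₀) ≤ Ji q F G T t xv αv i := by
  have hJ := joint_isProb H hN αv t xv
  have h1 := IsProb.abs_avg_const (hJ T).1 (hJ T).2
    (fun w => H.Gbd (w i) (emp w) (emp_isProb hN w))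
  have h2 := (Finset.abs_sum_le_sum_abs _ _).trans (Finset.sum_le_card_nsmul (Finset.Ico t T) _ _
    (fun s _ => IsProb.abs_avg_const (hJ s).1 (hJ s).2
      (fun w => H.Fbd s (w i) (emp w) (αv i s (w i) (emp w)) (emp_isProb hN w))))
  rw [nsmul_eq_mul, Nat.card_Ico] at h2
  unfold Ji
  have := (abs_le.1 h1).1
  have := (abs_le.1 h2).1
  linarith

lemma costM_bdd (H : Hyp q F G Lq C₀ ρ) (T t : ℕ) {ν : ℕ → S → ℝ} (hν : ∀ s, IsProb (ν s))
    (x₀ : S) (α : ℕ → S → (S → ℝ) → A) :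
    -(C₀ + (T - t : ℕ) * C₀) ≤ costM q F G T ν t x₀ α := by
  have hJ := chainM_isProb H hν α t x₀
  have h1 := IsProb.abs_avg_const (hJ T).1 (hJ T).2 (fun x => H.Gbd x _ (hν T))
  have h2 := (Finset.abs_sum_le_sum_abs _ _).trans (Finset.sum_le_card_nsmul (Finset.Ico t T) _ _
    (fun s _ => IsProb.abs_avg_const (hJ s).1 (hJ s).2
      (fun x => H.Fbd s x (ν s) (α s x (ν s)) (hν s))))
  rw [nsmul_eq_mul, Nat.card_Ico] at h2
  unfold costM
  have := (abs_le.1 h1).1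
  have := (abs_le.1 h2).1
  linarith

/-! Comparison of the two notions of control. -/

lemma flow_eq (α : ℕ → S → (S → ℝ) → A) (t : ℕ) (μ : S → ℝ) (s : ℕ) :
    flow q (fun s x => α s x (flowM q α t μ s)) t μ s = flowM q α t μ s := by
  induction s with
  | zero => rfl
  | succ s ih =>
    rw [flow, flowM, ih]

lemma chain_eq (ν : ℕ → S → ℝ) (α : ℕ → S → (S → ℝ) → A) (t : ℕ) (x₀ : S) (s : ℕ) :
    chain q ν (fun s x => α s x (ν s)) t x₀ s = chainM q ν α t x₀ s := by
  induction s with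
  | zero => rfl
  | succ s ih =>
    rw [chain, chainM, ih]

lemma cost_eq (T : ℕ) (ν : ℕ → S → ℝ) (α : ℕ → S → (S → ℝ) → A) (t : ℕ) (x₀ : S) :
    cost q F G T ν t x₀ (fun s x => α s x (ν s)) = costM q F G T ν t x₀ α := by
  simp only [cost, costM, chain_eq]

lemma cost_const (T : ℕ) (ν : ℕ → S → ℝ) (α : ℕ → S → A) (t : ℕ) (x₀ : S) :
    cost q F G T ν t x₀ α = costM q F G T ν t x₀ (fun s x _ => α s x) :=
  cost_eq T ν (fun s x _ => α s x) t x₀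

lemma lip_const {L : ℝ} (hL : 0 ≤ L) (α : ℕ → S → A) :
    LipCtrl L (fun s x (_ : S → ℝ) => α s x) := by
  intro s x μ ν
  simpa using mul_nonneg hL (W1_nonneg μ ν)

lemma exists_index {N : ℕ} {w : Fin N → S} {x : S} (h : 0 < emp w x) : ∃ i, w i = x := by
  by_contra hcon
  push Not at hcon
  simp [emp, hcon] at h

lemma first_incl (H : Hyp q F G Lq C₀ ρ) (T t : ℕ) {μ : S → ℝ}
    (hμ : IsProb μ) (xv : (N : ℕ) → Fin N → S)
    (hxv : ∃ N₀ : ℕ, ∀ N ≥ N₀, ∀ x, 0 < emp (xv N) x)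
    (hconv : Filter.Tendsto (fun N => W1 (emp (xv N)) μ) Filter.atTop (nhds 0)) :
    (⋂ (ε : ℝ) (_ : 0 < ε), ⋃ (L : ℝ) (_ : 0 ≤ L),
        ⋂ (n : ℕ), ⋃ (N : ℕ) (_ : n ≤ N), setValueN q F G T ε L t (xv N))
        ⊆ setValue q F G T t μ := by
  intro φ hφ
  simp only [Set.mem_iInter, Set.mem_iUnion, setValue] at hφ ⊢
  intro ε hε
  obtain ⟨L, hL, hφ⟩ := hφ (ε / 3) (by positivity)
  obtain ⟨N₀, hN₀⟩ := hxv
  obtain ⟨N₁, hN₁⟩ := Filter.eventually_atTop.1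
    (cost_conv H hL T t hμ xv hconv (ε / 3) (by positivity))
  obtain ⟨N, hN, α, ⟨hα, heq⟩, hφα⟩ := hφ (max (max N₀ N₁) 1)
  have hNa : N₀ ≤ N := (le_max_left _ _).trans ((le_max_left _ _).trans hN)
  have hNb : N₁ ≤ N := (le_max_right _ _).trans ((le_max_left _ _).trans hN)
  have hNc : 1 ≤ N := (le_max_right _ _).trans hN
  have hcv := hN₁ N hNb
  have hfl : flow q (fun s x => α s x (flowM q α t μ s)) t μ = flowM q α t μ :=
    funext fun s => flow_eq α t μ s
  refine ⟨fun s x => α s x (flowM q α t μ s), fun x => ?_, fun x => ?_⟩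
  · obtain ⟨i, rfl⟩ := exists_index (hN₀ N hNa x)
    rw [hfl, cost_eq, ← sub_le_iff_le_add]
    unfold value
    refine le_csInf ⟨_, fun s x => α s x (flowM q α t μ s), rfl⟩ ?_
    rintro r ⟨αt, rfl⟩
    rw [cost_const]
    have hαt := lip_const hL αt
    have h1 := abs_le.1 (hcv α α hα hα i)
    have h2 := abs_le.1 (hcv α _ hα hαt i)
    rw [replaceI_same] at h1
    have h3 := heq i
    have h4 : vNi q F G T L t (xv N) α i ≤
        Ji q F G T t (xv N) (replaceI α (fun s x _ => αt s x) i) i := by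
      refine csInf_le ⟨-(C₀ + (T - t : ℕ) * C₀), ?_⟩ ⟨_, hαt, rfl⟩
      rintro r ⟨β, _, rfl⟩
      exact Ji_bdd H T t hNc _ _ _
    linarith [h1.1, h1.2, h2.1, h2.2]
  · obtain ⟨i, rfl⟩ := exists_index (hN₀ N hNa x)
    rw [hfl, cost_eq]
    have h1 := hcv α α hα hα i
    rw [replaceI_same] at h1
    have h2 := hφα i
    have h3 := abs_sub_le (φ (xv N i)) (Ji q F G T t (xv N) (fun _ => α) i)
      (costM q F G T (flowM q α t μ) t (xv N i) α)
    linarith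

lemma second_incl (H : Hyp q F G Lq C₀ ρ) (T t : ℕ) {μ : S → ℝ}
    (hμ : IsProb μ) (xv : (N : ℕ) → Fin N → S)
    (hconv : Filter.Tendsto (fun N => W1 (emp (xv N)) μ) Filter.atTop (nhds 0)) :
    setValue q F G T t μ ⊆
      (⋂ (ε : ℝ) (_ : 0 < ε),
        ⋃ (n : ℕ), ⋂ (N : ℕ) (_ : n ≤ N), setValueN q F G T ε 0 t (xv N)) := by
  intro φ hφ
  simp only [Set.mem_iInter, Set.mem_iUnion, setValue] at hφ ⊢
  intro ε hε
  obtain ⟨α, heq, hφα⟩ := hφ (ε / 3) (by positivity)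
  obtain ⟨N₁, hN₁⟩ := Filter.eventually_atTop.1
    (cost_conv H le_rfl T t hμ xv hconv (ε / 3) (by positivity))
  refine ⟨N₁, fun N hN => ?_⟩
  have hcv := hN₁ N hN
  set αc : ℕ → S → (S → ℝ) → A := fun s x _ => α s x with hαc
  have hα : LipCtrl 0 αc := lip_const le_rfl α
  have hfl : flow q α t μ = flowM q αc t μ := funext fun s => flow_eq αc t μ s
  refine ⟨αc, ⟨hα, fun i => ?_⟩, fun i => ?_⟩
  · rw [← sub_le_iff_le_add]
    unfold vNi
    refine le_csInf ⟨_, αc, hα, rfl⟩ ?_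
    rintro r ⟨αt, hαt, rfl⟩
    have h1 := abs_le.1 (hcv αc αc hα hα i)
    have h2 := abs_le.1 (hcv αc αt hα hαt i)
    rw [replaceI_same] at h1
    have h3 := heq (xv N i)
    rw [hfl, cost_const] at h3
    have h4 : value q F G T (flowM q αc t μ) t (xv N i) ≤
        costM q F G T (flowM q αc t μ) t (xv N i) αt := by
      refine csInf_le ⟨-(C₀ + (T - t : ℕ) * C₀), ?_⟩
        ⟨fun s x => αt s x (flowM q αc t μ s), (cost_eq _ _ _ _ _).symm⟩
      rintro r ⟨β, rfl⟩
      rw [cost_const]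
      exact costM_bdd H T t (flowM_isProb H αc t hμ) _ _
    linarith [h1.1, h1.2, h2.1, h2.2]
  · have h1 := hcv αc αc hα hα i
    rw [replaceI_same, abs_sub_comm] at h1
    have h2 := hφα (xv N i)
    rw [hfl, cost_const] at h2
    have h3 := abs_sub_le (φ (xv N i)) (costM q F G T (flowM q αc t μ) t (xv N i) αc)
      (Ji q F G T t (xv N) (fun _ => αc) i)
    linarith

end Helpers

end MFGSetValue

open MFGSetValue

/-- Theorem 3.5, convergence of the set values with homogeneous
equilibria.  Assume `q` is Lipschitz in `(μ,a)` and `F, G` are bounded and uniformly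
continuous in `(μ,a)`; let `x⃗ = x⃗^N ∈ 𝕊^N₀` with `μ^N_{x⃗} → μ ∈ 𝒫₀(𝕊)` in `W₁`.
Then
`⋂_{ε>0} ⋃_{L≥0} limsup_N 𝕍^{N,ε,L}_state ⊆ 𝕍_state(t,μ) ⊆ ⋂_{ε>0} liminf_N 𝕍^{N,ε,0}_state`,
and in fact all three sets are equal. -/
theorem set_value_convergence
    {S A : Type*} [Fintype S] [DecidableEq S] [PseudoMetricSpace A]
    (T : ℕ) (q : ℕ → S → (S → ℝ) → A → S → ℝ)
    (F : ℕ → S → (S → ℝ) → A → ℝ) (G : S → (S → ℝ) → ℝ)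
    (Lq C₀ : ℝ) (ρ : ℝ → ℝ)
    (hρmono : Monotone ρ)
    (hρ0 : Filter.Tendsto ρ (nhdsWithin 0 (Set.Ioi 0)) (nhds 0))
    (hq01 : ∀ s x μ a y, IsProb μ → 0 < q s x μ a y ∧ q s x μ a y < 1)
    (hqsum : ∀ s x μ a, IsProb μ → ∑ y, q s x μ a y = 1)
    (hqLip : ∀ s x μ ν a b y, IsProb μ → IsProb ν →
      |q s x μ a y - q s x ν b y| ≤ Lq * (W1 μ ν + dist a b))
    (hFbd : ∀ s x μ a, IsProb μ → |F s x μ a| ≤ C₀)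
    (hGbd : ∀ x μ, IsProb μ → |G x μ| ≤ C₀)
    (hFuc : ∀ s x μ ν a b, IsProb μ → IsProb ν →
      |F s x μ a - F s x ν b| ≤ ρ (W1 μ ν + dist a b))
    (hGuc : ∀ x μ ν, IsProb μ → IsProb ν → |G x μ - G x ν| ≤ ρ (W1 μ ν))
    (t : ℕ) (ht : t ≤ T)
    (μ : S → ℝ) (hμ : IsProb μ) (hμfull : ∀ x, 0 < μ x)
    (xv : (N : ℕ) → Fin N → S)
    (hxv : ∃ N₀ : ℕ, ∀ N ≥ N₀, ∀ x, 0 < emp (xv N) x)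
    (hconv : Filter.Tendsto (fun N => W1 (emp (xv N)) μ) Filter.atTop (nhds 0)) :
    (⋂ (ε : ℝ) (_ : 0 < ε), ⋃ (L : ℝ) (_ : 0 ≤ L),
        ⋂ (n : ℕ), ⋃ (N : ℕ) (_ : n ≤ N), setValueN q F G T ε L t (xv N))
        ⊆ setValue q F G T t μ ∧
    setValue q F G T t μ ⊆
      (⋂ (ε : ℝ) (_ : 0 < ε),
        ⋃ (n : ℕ), ⋂ (N : ℕ) (_ : n ≤ N), setValueN q F G T ε 0 t (xv N)) ∧
    (⋂ (ε : ℝ) (_ : 0 < ε), ⋃ (L : ℝ) (_ : 0 ≤ L),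
        ⋂ (n : ℕ), ⋃ (N : ℕ) (_ : n ≤ N), setValueN q F G T ε L t (xv N))
        = setValue q F G T t μ ∧
    setValue q F G T t μ =
      (⋂ (ε : ℝ) (_ : 0 < ε),
        ⋃ (n : ℕ), ⋂ (N : ℕ) (_ : n ≤ N), setValueN q F G T ε 0 t (xv N)) := by
  have H : Hyp q F G |Lq| |C₀| ρ :=
    { Lq0 := abs_nonneg _
      C0 := abs_nonneg _
      mono := hρmono
      lim := hρ0
      qprob := fun s x m a hm => ⟨fun y => (hq01 s x m a y hm).1.le, hqsum s x m a hm⟩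
      qLip := fun s x m n a b y hm hn => (hqLip s x m n a b y hm hn).trans
        (mul_le_mul_of_nonneg_right (le_abs_self _) (add_nonneg (W1_nonneg m n) dist_nonneg))
      Fbd := fun s x m a hm => (hFbd s x m a hm).trans (le_abs_self _)
      Gbd := fun x m hm => (hGbd x m hm).trans (le_abs_self _)
      Fuc := hFuc
      Guc := hGuc }
  have h1 := first_incl H T t hμ xv hxv hconv
  have h2 := second_incl H T t hμ xv hconv
  have h3 : (⋂ (ε : ℝ) (_ : 0 < ε),
        ⋃ (n : ℕ), ⋂ (N : ℕ) (_ : n ≤ N), setValueN q F G T ε 0 t (xv N)) ⊆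
      (⋂ (ε : ℝ) (_ : 0 < ε), ⋃ (L : ℝ) (_ : 0 ≤ L),
        ⋂ (n : ℕ), ⋃ (N : ℕ) (_ : n ≤ N), setValueN q F G T ε L t (xv N)) := by
    intro φ hφ
    simp only [Set.mem_iInter, Set.mem_iUnion] at hφ ⊢
    intro ε hε
    obtain ⟨n, hn⟩ := hφ ε hε
    exact ⟨0, le_rfl, fun m => ⟨max n m, le_max_right _ _, hn _ (le_max_left _ _)⟩⟩
  exact ⟨h1, h2, h1.antisymm (h2.trans h3), h2.antisymm (h3.trans h1)⟩
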